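/- Let x₀, x₁, x₂, x₃ be real numbers with x₀² + x₁² + x₂² + x₃² = 1. Define B₁ = max{ 2√((−1+2x₁²)² + (−1+2x₀²)²), 2√((−1+2x₀²+2x₁²)² + (1−2x₀²)²), 2√((−1+2x₀²+2x₁²)² + (−1+2x₁²)²) }; B₂ = max{ 2√((1−2x₀²−2x₂²)² + (1−2x₁²−2x₂²)²), 2√((1−2x₁²−2x₀²)² + (1−2x₂²−2x₀²)²), 2√((1−2x₀²−2x₁²)² + (1−2x₂²−2x₁²)²) }; B₃ = max{ 4√((x₀x₂+x₁x₃)² + (x₁x₂+x₀x₃)²), 4√((x₀x₁+x₂x₃)² + (x₁x₂+x₀x₃)²), 4√((x₀x₂+x₁x₃)² + (x₀x₁+x₂x₃)²) }; B₄ = max{ 4√((x₀x₁−x₂x₃)² + (x₀x₂−x₁x₃)²), 4√((x₀x₂−x₁x₃)² + (x₁x₂−x₀x₃)²), 4√((x₁x₂−x₀x₃)² + (x₀x₁−x₂x₃)²) }. Then it is not the case that B₁ > 2 and B₂ > 2 and B₃ > 2 and B₄ > 2; equivalently, min{B₁, B₂, B₃, B₄} ≤ 2. -/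

import Mathlib

/-- For a unit vector whose coordinates `a`, `b`, `c`, `d` have nonpositive product,
`(a * b + c * d) ^ 2 + (a * c + b * d) ^ 2 = (a ^ 2 + d ^ 2) * (b ^ 2 + c ^ 2) + 4 * a * b * c * d`
is at most `1 / 4`. -/
theorem four_mul_sqrt_sq_add_sq_le_two {a b c d : ℝ} (h : a ^ 2 + b ^ 2 + c ^ 2 + d ^ 2 = 1)
    (hp : a * b * c * d ≤ 0) :
    4 * Real.sqrt ((a * b + c * d) ^ 2 + (a * c + b * d) ^ 2) ≤ 2 := by
  have hs : (a * b + c * d) ^ 2 + (a * c + b * d) ^ 2 ≤ (1 / 2) ^ 2 := by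
    have hd : d ^ 2 = 1 - a ^ 2 - b ^ 2 - c ^ 2 := by linarith
    have he : (a * b + c * d) ^ 2 + (a * c + b * d) ^ 2 =
        (a ^ 2 + d ^ 2) * (b ^ 2 + c ^ 2) + 4 * (a * b * c * d) := by ring
    rw [he, hd]
    nlinarith [sq_nonneg (b ^ 2 + c ^ 2 - 1 / 2)]
  have := Real.sqrt_le_iff.mpr ⟨by norm_num, hs⟩
  linarith

theorem max_four_mul_sqrt_le_two {a b c d : ℝ} (h : a ^ 2 + b ^ 2 + c ^ 2 + d ^ 2 = 1)
    (hp : a * b * c * d ≤ 0) :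
    max (4 * Real.sqrt ((a * c + b * d) ^ 2 + (b * c + a * d) ^ 2))
      (max (4 * Real.sqrt ((a * b + c * d) ^ 2 + (b * c + a * d) ^ 2))
        (4 * Real.sqrt ((a * c + b * d) ^ 2 + (a * b + c * d) ^ 2))) ≤ 2 := by
  refine max_le ?_ (max_le ?_ ?_)
  · rw [mul_comm a c, mul_comm b c]
    exact four_mul_sqrt_sq_add_sq_le_two (by linarith) (by linarith)
  · rw [mul_comm a b]
    exact four_mul_sqrt_sq_add_sq_le_two (by linarith) (by linarith)
  · rw [add_comm ((a * c + b * d) ^ 2)]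
    exact four_mul_sqrt_sq_add_sq_le_two h hp


/-- key claim in Theorem 1 of the paper: for a τ_min-class state with
real parameters `x₀,…,x₃`, `∑ xⱼ² = 1`, the four three-qubit reduced states cannot all
violate the 4th facet inequality (local bound 2) simultaneously. -/
theorem persistency_stmt13 (x0 x1 x2 x3 : ℝ)
    (hx : x0 ^ 2 + x1 ^ 2 + x2 ^ 2 + x3 ^ 2 = 1) :
    ¬ (max (2 * Real.sqrt ((-1 + 2 * x1 ^ 2) ^ 2 + (-1 + 2 * x0 ^ 2) ^ 2))
          (max (2 * Real.sqrt ((-1 + 2 * x0 ^ 2 + 2 * x1 ^ 2) ^ 2 + (1 - 2 * x0 ^ 2) ^ 2))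
            (2 * Real.sqrt ((-1 + 2 * x0 ^ 2 + 2 * x1 ^ 2) ^ 2 + (-1 + 2 * x1 ^ 2) ^ 2))) > 2
      ∧ max (2 * Real.sqrt ((1 - 2 * x0 ^ 2 - 2 * x2 ^ 2) ^ 2 + (1 - 2 * x1 ^ 2 - 2 * x2 ^ 2) ^ 2))
          (max (2 * Real.sqrt ((1 - 2 * x1 ^ 2 - 2 * x0 ^ 2) ^ 2 + (1 - 2 * x2 ^ 2 - 2 * x0 ^ 2) ^ 2))
            (2 * Real.sqrt ((1 - 2 * x0 ^ 2 - 2 * x1 ^ 2) ^ 2 + (1 - 2 * x2 ^ 2 - 2 * x1 ^ 2) ^ 2))) > 2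
      ∧ max (4 * Real.sqrt ((x0 * x2 + x1 * x3) ^ 2 + (x1 * x2 + x0 * x3) ^ 2))
          (max (4 * Real.sqrt ((x0 * x1 + x2 * x3) ^ 2 + (x1 * x2 + x0 * x3) ^ 2))
            (4 * Real.sqrt ((x0 * x2 + x1 * x3) ^ 2 + (x0 * x1 + x2 * x3) ^ 2))) > 2
      ∧ max (4 * Real.sqrt ((x0 * x1 - x2 * x3) ^ 2 + (x0 * x2 - x1 * x3) ^ 2))
          (max (4 * Real.sqrt ((x0 * x2 - x1 * x3) ^ 2 + (x1 * x2 - x0 * x3) ^ 2))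
            (4 * Real.sqrt ((x1 * x2 - x0 * x3) ^ 2 + (x0 * x1 - x2 * x3) ^ 2))) > 2) := by
  rintro ⟨-, -, h₃, h₄⟩
  rcases le_total (x0 * x1 * x2 * x3) 0 with hp | hp
  · exact absurd h₃ (max_four_mul_sqrt_le_two hx hp).not_gt
  · have h := max_four_mul_sqrt_le_two (a := x0) (b := x1) (c := x2) (d := -x3)
      (by linarith [neg_sq x3]) (by linarith)
    simp only [mul_neg, ← sub_eq_add_neg, max_le_iff] at h
    obtain ⟨h₁₂, h₀₂, h₀₁⟩ := h
    rw [add_comm] at h₀₁ h₀₂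
    exact absurd h₄ (max_le h₀₁ (max_le h₁₂ h₀₂)).not_gt
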